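/- Let κ satisfy the energy, consistency, and domination principles. Then for every μ ∈ E⁺ and every set A ⊂ X, the inner balayage μ^A belongs to E'_A and is the unique measure in E'_A whose potential coincides with κμ nearly everywhere on A: if ν ∈ E'_A and κν = κμ n.e. on A, then ν = μ^A. -/

import Mathlib

open MeasureTheory Filter Topology Set
open scoped ENNReal NNReal

namespace Balayage

variable {X : Type*} [TopologicalSpace X] [T2Space X] [LocallyCompactSpace X]
  [MeasurableSpace X] [BorelSpace X]

/-- The potential `κμ(x) := ∫ κ(x,y) dμ(y)`. -/
noncomputable def pot (κ : X → X → ℝ≥0∞) (μ : Measure X) (x : X) : ℝ≥0∞ :=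
  ∫⁻ y, κ x y ∂μ

/-- The mutual energy `κ(μ,ν) := ∬ κ(x,y) d(μ⊗ν)(x,y)`. -/
noncomputable def energy (κ : X → X → ℝ≥0∞) (μ ν : Measure X) : ℝ≥0∞ :=
  ∫⁻ x, pot κ ν x ∂μ

/-- A positive Radon measure: locally finite and inner regular. -/
def IsRadon (μ : Measure X) : Prop :=
  μ.InnerRegular ∧ IsLocallyFiniteMeasure μ

/-- `E⁺`: the positive Radon measures of finite energy. -/
def Eplus (κ : X → X → ℝ≥0∞) : Set (Measure X) :=
  {μ | IsRadon μ ∧ energy κ μ μ < ⊤}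

/-- `μ` is concentrated on `A`: `A` is `μ`-measurable and `X∖A` is locally `μ`-negligible. -/
def ConcOn (μ : Measure X) (A : Set X) : Prop :=
  NullMeasurableSet A μ ∧ ∀ K : Set X, IsCompact K → μ (Aᶜ ∩ K) = 0

/-- `E⁺_A`: measures of finite energy concentrated on `A`. -/
def EplusOn (κ : X → X → ℝ≥0∞) (A : Set X) : Set (Measure X) :=
  {μ ∈ Eplus κ | ConcOn μ A}

/-- The inner capacity `c_*(A)`. -/
noncomputable def innerCap (κ : X → X → ℝ≥0∞) (A : Set X) : ℝ≥0∞ :=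
  (⨅ μ ∈ {μ ∈ EplusOn κ A | μ Set.univ = 1}, energy κ μ μ)⁻¹

/-- `P` holds nearly everywhere on `A`: the set where it fails has inner capacity zero. -/
def NEOn (κ : X → X → ℝ≥0∞) (A : Set X) (P : X → Prop) : Prop :=
  innerCap κ {x | x ∈ A ∧ ¬ P x} = 0

/-- The outer capacity `c^*(A)`. -/
noncomputable def outerCap (κ : X → X → ℝ≥0∞) (A : Set X) : ℝ≥0∞ :=
  ⨅ D ∈ {D : Set X | IsOpen D ∧ A ⊆ D}, innerCap κ D

/-- `P` holds quasi-everywhere on `A`: the set where it fails has outer capacity zero. -/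
def QEOn (κ : X → X → ℝ≥0∞) (A : Set X) (P : X → Prop) : Prop :=
  outerCap κ {x | x ∈ A ∧ ¬ P x} = 0

/-- The class `Λ_{A,μ}` of measures `ν ∈ E⁺` with `κν ≥ κμ` n.e. on `A`. -/
def InnerLam (κ : X → X → ℝ≥0∞) (A : Set X) (μ : Measure X) : Set (Measure X) :=
  {ν ∈ Eplus κ | NEOn κ A (fun x => pot κ μ x ≤ pot κ ν x)}

/-- The class `Λ*_{A,μ}` of measures `ν ∈ E⁺` with `κν ≥ κμ` q.e. on `A`. -/
def OuterLam (κ : X → X → ℝ≥0∞) (A : Set X) (μ : Measure X) : Set (Measure X) :=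
  {ν ∈ Eplus κ | QEOn κ A (fun x => pot κ μ x ≤ pot κ ν x)}

/-- `b` is the inner balayage `μ^A`: the measure of minimal potential in `Λ_{A,μ}`. -/
def IsInnerBal (κ : X → X → ℝ≥0∞) (A : Set X) (μ b : Measure X) : Prop :=
  b ∈ InnerLam κ A μ ∧ ∀ ν ∈ InnerLam κ A μ, ∀ x, pot κ b x ≤ pot κ ν x

/-- `b` is the outer balayage `μ^{*A}`: the measure of minimal potential in `Λ*_{A,μ}`. -/
def IsOuterBal (κ : X → X → ℝ≥0∞) (A : Set X) (μ b : Measure X) : Prop :=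
  b ∈ OuterLam κ A μ ∧ ∀ ν ∈ OuterLam κ A μ, ∀ x, pot κ b x ≤ pot κ ν x

/-- The strong (energy) distance `‖μ − ν‖`. -/
noncomputable def strDist (κ : X → X → ℝ≥0∞) (μ ν : Measure X) : ℝ :=
  Real.sqrt ((energy κ μ μ).toReal - 2 * (energy κ μ ν).toReal + (energy κ ν ν).toReal)

/-- The energy principle (strict positive definiteness). -/
def EnergyPrinciple (κ : X → X → ℝ≥0∞) : Prop :=
  ∀ μ ∈ Eplus κ, ∀ ν ∈ Eplus κ,
    2 * energy κ μ ν ≤ energy κ μ μ + energy κ ν ν ∧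
      (2 * energy κ μ ν = energy κ μ μ + energy κ ν ν → μ = ν)

/-- Vague convergence of a net of measures along a filter. -/
def VagueConv {ι : Type*} (F : Filter ι) (m : ι → Measure X) (ν : Measure X) : Prop :=
  ∀ f : X → ℝ, Continuous f → HasCompactSupport f →
    Tendsto (fun i => ∫ x, f x ∂(m i)) F (nhds (∫ x, f x ∂ν))

/-- A net of measures is strong Cauchy (for the energy metric) along a filter. -/
def StrongCauchy (κ : X → X → ℝ≥0∞) {ι : Type*} (F : Filter ι) (m : ι → Measure X) : Prop :=
  ∀ ε : ℝ, 0 < ε → ∃ s ∈ F, ∀ i ∈ s, ∀ j ∈ s, strDist κ (m i) (m j) < ε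

/-- The consistency principle: every strong Cauchy net in `E⁺` converges strongly
to each of its vague limit points. -/
def Consistent (κ : X → X → ℝ≥0∞) : Prop :=
  ∀ (ι : Type) (F : Filter ι) (m : ι → Measure X), F.NeBot →
    (∀ i, m i ∈ Eplus κ) → StrongCauchy κ F m →
    ∀ ν : Measure X, (∃ G : Filter ι, G ≤ F ∧ G.NeBot ∧ VagueConv G m ν) →
      Tendsto (fun i => strDist κ (m i) ν) F (nhds 0)

/-- The domination principle. -/
def Domination (κ : X → X → ℝ≥0∞) : Prop :=
  ∀ μ ∈ Eplus κ, ∀ ν ∈ Eplus κ,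
    (∀ᵐ x ∂μ, pot κ μ x ≤ pot κ ν x) → ∀ x, pot κ μ x ≤ pot κ ν x

/-- A kernel: symmetric and lower semicontinuous. -/
structure IsKernel (κ : X → X → ℝ≥0∞) : Prop where
  symm : ∀ x y, κ x y = κ y x
  lsc : LowerSemicontinuous (Function.uncurry κ)

/-- `E'_A`: the strong closure of `E⁺_A` within `E⁺`. -/
def EclosOn (κ : X → X → ℝ≥0∞) (A : Set X) : Set (Measure X) :=
  {ν ∈ Eplus κ | ∀ ε : ℝ, 0 < ε → ∃ μ ∈ EplusOn κ A, strDist κ ν μ < ε}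

/-- The (real-valued) potential of the signed measure `λ = lp − lm`. -/
noncomputable def spot (κ : X → X → ℝ≥0∞) (lp lm : Measure X) (x : X) : ℝ :=
  (pot κ lp x).toReal - (pot κ lm x).toReal

/-- Assumption (A2): every `f ∈ C_c(X)` is the limit, uniformly with supports in one fixed
compact set, of a sequence of potentials of signed measures of finite energy that are
continuous and compactly supported. -/
def A2 (κ : X → X → ℝ≥0∞) : Prop :=
  ∀ f : X → ℝ, Continuous f → HasCompactSupport f →
    ∃ (K : Set X) (lp lm : ℕ → Measure X), IsCompact K ∧ tsupport f ⊆ K ∧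
      (∀ j, lp j ∈ Eplus κ ∧ lm j ∈ Eplus κ) ∧
      (∀ j x, pot κ (lp j) x ≠ ⊤ ∨ pot κ (lm j) x ≠ ⊤) ∧
      (∀ j, Continuous (spot κ (lp j) (lm j))) ∧
      (∀ j, tsupport (spot κ (lp j) (lm j)) ⊆ K) ∧
      TendstoUniformly (fun j => spot κ (lp j) (lm j)) f atTop

set_option linter.unusedSectionVars false

/-- A lower semicontinuous integral against an inner regular measure is approximated from below
by integrals of compactly supported continuous functions. -/
theorem exists_continuous_le_lt_lintegral {Y : Type*} [TopologicalSpace Y] [T2Space Y]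
    [LocallyCompactSpace Y] [MeasurableSpace Y] [BorelSpace Y] {f : Y → ℝ≥0∞}
    (hf : LowerSemicontinuous f) (ν : Measure Y) [ν.InnerRegular] {b : ℝ≥0∞}
    (hb : b < ∫⁻ x, f x ∂ν) :
    ∃ g : Y → ℝ≥0, Continuous g ∧ HasCompactSupport g ∧ (∀ x, (g x : ℝ≥0∞) ≤ f x) ∧
      b < ∫⁻ x, g x ∂ν := by
  let G := {g : Y → ℝ≥0 // Continuous g ∧ HasCompactSupport g ∧ ∀ x, (g x : ℝ≥0∞) ≤ f x}
  have : Nonempty G := ⟨⟨fun _ => 0, continuous_const, HasCompactSupport.zero, by simp⟩⟩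
  have : IsDirectedOrder G := ⟨fun g h => by
    refine ⟨⟨fun x => max (g.1 x) (h.1 x), g.2.1.max h.2.1, ?_, fun x => ?_⟩,
      fun x => le_max_left _ _, fun x => le_max_right _ _⟩
    · refine HasCompactSupport.intro (g.2.2.1.isCompact.union h.2.2.1.isCompact) fun x hx => ?_
      rw [Set.mem_union, not_or] at hx
      simp [image_eq_zero_of_notMem_tsupport hx.1, image_eq_zero_of_notMem_tsupport hx.2]
    · rw [ENNReal.coe_max]
      exact max_le (g.2.2.2 x) (h.2.2.2 x)⟩
  rw [lintegral_eq_nnreal, lt_iSup_iff] at hb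
  obtain ⟨φ, hb⟩ := hb
  rw [lt_iSup_iff] at hb
  obtain ⟨hφ, hb⟩ := hb
  have hev (c : ℝ≥0) : Tendsto
      (fun g : G => min (∫⁻ x in φ ⁻¹' {c}, g.1 x ∂ν) (c * ν (φ ⁻¹' {c}))) atTop
      (𝓝 (c * ν (φ ⁻¹' {c}))) := by
    refine tendsto_order.2 ⟨fun b' hb' => ?_, fun b' hb' =>
      Eventually.of_forall fun g => (min_le_right _ _).trans_lt hb'⟩
    obtain ⟨c', hc', K, hKc, hK, hKb⟩ : ∃ c' : ℝ≥0, c' < c ∧ ∃ K ⊆ φ ⁻¹' {c}, IsCompact K ∧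
        b' < c' * ν K := by
      rw [(φ.measurableSet_fiber c).measure_eq_iSup_isCompact] at hb'
      simp only [ENNReal.mul_iSup, lt_iSup_iff] at hb'
      obtain ⟨K, hKc, hK, hKb⟩ := hb'
      have : ∃ c' : ℝ≥0, c' < c ∧ b' < c' * ν K := by
        by_contra! hcon
        have hc0 : c ≠ 0 := by rintro rfl; simp at hKb
        refine hKb.not_ge ?_
        have h1 : Tendsto (fun c' : ℝ≥0 => (c' : ℝ≥0∞) * ν K) (𝓝[<] c) (𝓝 (c * ν K)) := by
          refine ENNReal.Tendsto.mul_const ?_ (Or.inl (by simpa using hc0))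
          exact (ENNReal.continuous_coe.tendsto c).mono_left nhdsWithin_le_nhds
        have : (𝓝[<] c).NeBot := nhdsLT_neBot_of_exists_lt ⟨0, pos_iff_ne_zero.2 hc0⟩
        exact le_of_tendsto h1 (eventually_nhdsWithin_of_forall fun c' hc' => hcon c' hc')
      obtain ⟨c', h1, h2⟩ := this
      exact ⟨c', h1, K, hKc, hK, h2⟩
    obtain ⟨u, hu1, hu2, hu3, hu4⟩ := exists_continuousMap_one_of_isCompact_subset_isOpen hK
      (hf.isOpen_preimage (c' : ℝ≥0∞)) (fun x hx => by
        have h1 := hφ x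
        rw [show φ x = c from hKc hx] at h1
        exact (ENNReal.coe_lt_coe.2 hc').trans_le h1)
    have hsupp : ∀ x, u x ≠ 0 → (c' : ℝ≥0∞) < f x := fun x hx => hu3 (subset_tsupport _ hx)
    let g₀ : G := ⟨fun x => c' * (u x).toNNReal, by fun_prop, by
      refine HasCompactSupport.intro (hu2 : IsCompact (tsupport u)) fun x hx => ?_
      simp [image_eq_zero_of_notMem_tsupport hx], fun x => by
        by_cases hx : u x = 0
        · simp [hx]
        · refine le_trans ?_ (hsupp x hx).le
          rw [ENNReal.coe_le_coe]
          refine mul_le_of_le_one_right zero_le ?_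
          simpa using (hu4 x).2⟩
    filter_upwards [eventually_ge_atTop g₀] with g hg
    refine lt_min ?_ (hKb.trans_le (mul_le_mul' (by exact_mod_cast hc'.le) (measure_mono hKc)))
    calc b' < c' * ν K := hKb
      _ = ∫⁻ x in K, c' ∂ν := by simp
      _ ≤ ∫⁻ x in K, g.1 x ∂ν := setLIntegral_mono' hK.measurableSet fun x hx => by
          rw [ENNReal.coe_le_coe]
          refine le_trans ?_ (hg x)
          simp [g₀, hu1 hx]
      _ ≤ ∫⁻ x in φ ⁻¹' {c}, g.1 x ∂ν := lintegral_mono_set hKc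
  have hsum := tendsto_finsetSum φ.range fun c _ => hev c
  rw [SimpleFunc.map_lintegral] at hb
  obtain ⟨g, hg⟩ := (hsum.eventually (lt_mem_nhds hb)).exists
  refine ⟨g.1, g.2.1, g.2.2.1, g.2.2.2, hg.trans_le ?_⟩
  calc _ ≤ ∑ c ∈ φ.range, ∫⁻ x in φ ⁻¹' {c}, g.1 x ∂ν :=
        Finset.sum_le_sum fun c _ => min_le_left _ _
    _ = ∫⁻ x in ⋃ c ∈ φ.range, φ ⁻¹' {c}, g.1 x ∂ν := by
        rw [lintegral_biUnion_finset]
        · exact fun a _ b _ hab => Disjoint.preimage _ (by simpa using hab)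
        · exact fun c _ => φ.measurableSet_fiber c
    _ ≤ ∫⁻ x, g.1 x ∂ν := setLIntegral_le_lintegral _ _

/-- A Fatou-type lemma along arbitrary filters: both the integrands and the measures vary. -/
theorem eventually_lt_lintegral {Y ι : Type*} [TopologicalSpace Y] [T2Space Y]
    [LocallyCompactSpace Y] [MeasurableSpace Y] [BorelSpace Y] {f : Y → ℝ≥0∞}
    (hf : LowerSemicontinuous f) {ν : Measure Y} [ν.InnerRegular] {l : Filter ι}
    {F : ι → Y → ℝ≥0∞} {m : ι → Measure Y}
    (hm : ∀ g : Y → ℝ≥0, Continuous g → HasCompactSupport g →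
      ∀ b < ∫⁻ x, g x ∂ν, ∀ᶠ i in l, b < ∫⁻ x, g x ∂(m i))
    (hF : ∀ (c : ℝ≥0) (x : Y), (c : ℝ≥0∞) < f x →
      ∃ V ∈ 𝓝 x, ∀ᶠ i in l, ∀ y ∈ V, (c : ℝ≥0∞) < F i y)
    {b : ℝ≥0∞} (hb : b < ∫⁻ x, f x ∂ν) : ∀ᶠ i in l, b < ∫⁻ x, F i x ∂(m i) := by
  obtain ⟨g, hg, hgs, hgf, hbg⟩ := exists_continuous_le_lt_lintegral hf ν hb
  obtain ⟨n, hn⟩ : ∃ n : ℕ, b < ∫⁻ x, ((g x - 1 / ((n : ℝ≥0) + 1) : ℝ≥0) : ℝ≥0∞) ∂ν := by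
    have h1 := tendsto_one_div_add_atTop_nhds_zero_nat (𝕜 := ℝ≥0)
    have h2 : Tendsto (fun n : ℕ => ∫⁻ x, ((g x - 1 / ((n : ℝ≥0) + 1) : ℝ≥0) : ℝ≥0∞) ∂ν) atTop
        (𝓝 (∫⁻ x, g x ∂ν)) := by
      refine lintegral_tendsto_of_tendsto_of_monotone (fun n => ?_) (ae_of_all _ fun x => ?_)
        (ae_of_all _ fun x => ?_)
      · exact (by fun_prop : Continuous fun x => ((g x - 1 / ((n : ℝ≥0) + 1) : ℝ≥0) : ℝ≥0∞)
          ).measurable.aemeasurable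
      · intro p q hpq
        simp only
        gcongr
      · rw [ENNReal.tendsto_coe]
        simpa using (tendsto_const_nhds (x := g x)).sub h1
    exact (h2.eventually (lt_mem_nhds hbg)).exists
  set ε : ℝ≥0 := 1 / ((n : ℝ≥0) + 1) with hε
  have hε0 : 0 < ε := by positivity
  have hK : ∀ᶠ i in l, ∀ y ∈ tsupport g, ((g y - ε : ℝ≥0) : ℝ≥0∞) ≤ F i y := by
    refine hgs.isCompact.induction_on (p := fun S => ∀ᶠ i in l, ∀ y ∈ S,
      ((g y - ε : ℝ≥0) : ℝ≥0∞) ≤ F i y) (by simp) (fun S T hST hT => ?_) (fun S T hS hT => ?_)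
      (fun x _ => ?_)
    · filter_upwards [hT] with i hi y hy using hi y (hST hy)
    · filter_upwards [hS, hT] with i h1 h2 y hy using hy.elim (h1 y) (h2 y)
    · have hnear : ∀ᶠ y in 𝓝 x, g y < g x + ε / 2 :=
        hg.continuousAt.eventually (gt_mem_nhds (lt_add_of_pos_right _ (half_pos hε0)))
      by_cases hx : g x ≤ ε / 2
      · refine ⟨_, mem_nhdsWithin_of_mem_nhds hnear, Eventually.of_forall fun i y hy => ?_⟩
        have : g y - ε = 0 := tsub_eq_zero_of_le <| by
          refine (le_of_lt hy).trans ?_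
          calc g x + ε / 2 ≤ ε / 2 + ε / 2 := by gcongr
            _ = ε := add_halves ε
        simp [this]
      · push Not at hx
        have hlt : ((g x - ε / 2 : ℝ≥0) : ℝ≥0∞) < f x := by
          refine lt_of_lt_of_le ?_ (hgf x)
          rw [ENNReal.coe_lt_coe]
          exact tsub_lt_self ((half_pos hε0).trans hx) (half_pos hε0)
        obtain ⟨V, hV, hVl⟩ := hF _ x hlt
        refine ⟨_, mem_nhdsWithin_of_mem_nhds (inter_mem hnear hV), ?_⟩
        filter_upwards [hVl] with i hi y hy
        refine le_trans ?_ (hi y hy.2).le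
        rw [ENNReal.coe_le_coe, tsub_le_iff_right]
        refine (le_of_lt hy.1).trans ?_
        rw [← tsub_add_cancel_of_le hx.le, add_assoc, add_halves,
          tsub_add_cancel_of_le hx.le]
  have hlim := hm (fun x => g x - ε) (by fun_prop)
    (HasCompactSupport.intro hgs.isCompact fun x hx => by
      simp [image_eq_zero_of_notMem_tsupport hx]) b hn
  filter_upwards [hlim, hK] with i h1 h2
  refine h1.trans_le (lintegral_mono fun x => ?_)
  by_cases hx : x ∈ tsupport g
  · exact h2 x hx
  · simp [image_eq_zero_of_notMem_tsupport hx]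

theorem innerRegular_dirac {Y : Type*} [TopologicalSpace Y] [MeasurableSpace Y] (x : Y) :
    (Measure.dirac x).InnerRegular := ⟨fun U hU r hr => by
  by_cases hx : x ∈ U
  · refine ⟨{x}, by simpa using hx, isCompact_singleton, ?_⟩
    rw [Measure.dirac_apply_of_mem hx] at hr
    rwa [Measure.dirac_apply_of_mem (mem_singleton x)]
  · simp [Measure.dirac_apply' x hU, hx] at hr⟩

theorem IsKernel.eventually_lt {κ : X → X → ℝ≥0∞} (hker : IsKernel κ) {c : ℝ≥0∞} {x y : X}
    (h : c < κ x y) : ∃ V ∈ 𝓝 y, ∃ U ∈ 𝓝 x, ∀ x' ∈ U, ∀ y' ∈ V, c < κ x' y' := by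
  have h1 := hker.lsc (x, y) c h
  rw [nhds_prod_eq, Filter.eventually_prod_iff] at h1
  obtain ⟨p, hp, q, hq, h⟩ := h1
  exact ⟨{y | q y}, hq, {x | p x}, hp, fun x' hx' y' hy' => h hx' hy'⟩

theorem IsKernel.lowerSemicontinuous_right {κ : X → X → ℝ≥0∞} (hker : IsKernel κ) (x : X) :
    LowerSemicontinuous (κ x) := fun y c h => by
  obtain ⟨V, hV, U, hU, hUV⟩ := hker.eventually_lt h
  filter_upwards [hV] with y' hy' using hUV x (mem_of_mem_nhds hU) y' hy'

theorem VagueConv.eventually_lt_lintegral {ι : Type*} {G : Filter ι} {m : ι → Measure X}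
    {ν : Measure X} [IsFiniteMeasureOnCompacts ν] (hm : ∀ i, IsFiniteMeasureOnCompacts (m i))
    (h : VagueConv G m ν) (g : X → ℝ≥0) (hg : Continuous g) (hgs : HasCompactSupport g) :
    ∀ b < ∫⁻ x, g x ∂ν, ∀ᶠ i in G, b < ∫⁻ x, g x ∂(m i) := by
  intro b hb
  have hc : Continuous fun x => (g x : ℝ) := by fun_prop
  have hs : HasCompactSupport fun x => (g x : ℝ) :=
    hgs.comp_left (g := fun t : ℝ≥0 => (t : ℝ)) NNReal.coe_zero
  have key (μ : Measure X) [IsFiniteMeasureOnCompacts μ] :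
      ∫⁻ x, g x ∂μ = ENNReal.ofReal (∫ x, (g x : ℝ) ∂μ) :=
    lintegral_coe_eq_integral g (hc.integrable_of_hasCompactSupport hs)
  have h1 := (ENNReal.continuous_ofReal.tendsto _).comp (h _ hc hs)
  rw [key] at hb
  filter_upwards [h1.eventually (lt_mem_nhds hb)] with i hi
  have := hm i
  rw [key]
  exact hi

/-- Joint lower semicontinuity of the potential in the point and, vaguely, in the measure. -/
theorem eventually_lt_pot {κ : X → X → ℝ≥0∞} (hker : IsKernel κ) {ι : Type*} {G : Filter ι}
    {m : ι → Measure X} {ν : Measure X} [ν.InnerRegular]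
    (hm : ∀ g : X → ℝ≥0, Continuous g → HasCompactSupport g →
      ∀ b < ∫⁻ x, g x ∂ν, ∀ᶠ i in G, b < ∫⁻ x, g x ∂(m i))
    {x : X} {c : ℝ≥0∞} (hc : c < pot κ ν x) :
    ∀ᶠ p in 𝓝 x ×ˢ G, c < pot κ (m p.2) p.1 := by
  refine Balayage.eventually_lt_lintegral (hker.lowerSemicontinuous_right x)
    (F := fun p : X × ι => κ p.1) (m := fun p => m p.2) (fun g hg hgs b hb => ?_)
    (fun c y hcy => ?_) hc
  · exact tendsto_snd.eventually (hm g hg hgs b hb)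
  · obtain ⟨V, hV, U, hU, hUV⟩ := hker.eventually_lt hcy
    refine ⟨V, hV, ?_⟩
    filter_upwards [tendsto_fst.eventually hU] with p hp y hy using hUV _ hp _ hy

theorem lowerSemicontinuous_pot {κ : X → X → ℝ≥0∞} (hker : IsKernel κ) (μ : Measure X)
    [μ.InnerRegular] : LowerSemicontinuous (pot κ μ) := fun x c hc => by
  have h1 := eventually_lt_pot hker (G := pure ()) (m := fun _ => μ)
    (fun g _ _ b hb => Eventually.of_forall fun _ => hb) hc
  rw [prod_pure] at h1
  exact h1

theorem measurable_pot {κ : X → X → ℝ≥0∞} (hker : IsKernel κ) (μ : Measure X)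
    [μ.InnerRegular] : Measurable (pot κ μ) := (lowerSemicontinuous_pot hker μ).measurable

/-- The energy is vaguely lower semicontinuous. -/
theorem eventually_lt_energy {κ : X → X → ℝ≥0∞} (hker : IsKernel κ) {ι : Type*} {G : Filter ι}
    {m : ι → Measure X} {ν : Measure X} [ν.InnerRegular]
    (hm : ∀ g : X → ℝ≥0, Continuous g → HasCompactSupport g →
      ∀ b < ∫⁻ x, g x ∂ν, ∀ᶠ i in G, b < ∫⁻ x, g x ∂(m i))
    {c : ℝ≥0∞} (hc : c < energy κ ν ν) : ∀ᶠ i in G, c < energy κ (m i) (m i) := by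
  refine Balayage.eventually_lt_lintegral (lowerSemicontinuous_pot hker ν) hm
    (fun c x hcx => ?_) hc
  have h1 := eventually_lt_pot hker hm hcx
  rw [Filter.eventually_prod_iff] at h1
  obtain ⟨p, hp, q, hq, h⟩ := h1
  exact ⟨{x | p x}, hp, hq.mono fun i hi y hy => h hy hi⟩

theorem lintegral_lintegral_swap_of_hasCompactSupport {g : X × X → ℝ≥0} (hg : Continuous g)
    (hgs : HasCompactSupport g) (μ ν : Measure X) [IsFiniteMeasureOnCompacts μ]
    [IsFiniteMeasureOnCompacts ν] :
    ∫⁻ x, ∫⁻ y, g (x, y) ∂μ ∂ν = ∫⁻ y, ∫⁻ x, g (x, y) ∂ν ∂μ := by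
  set U := Prod.fst '' tsupport g
  set V := Prod.snd '' tsupport g
  have hU : IsCompact U := hgs.isCompact.image continuous_fst
  have hV : IsCompact V := hgs.isCompact.image continuous_snd
  have : Fact (ν U < ∞) := ⟨hU.measure_lt_top⟩
  have : Fact (μ V < ∞) := ⟨hV.measure_lt_top⟩
  have h0U {x y : X} (hx : x ∉ U) : g (x, y) = 0 :=
    image_eq_zero_of_notMem_tsupport fun h => hx ⟨_, h, rfl⟩
  have h0V {x y : X} (hy : y ∉ V) : g (x, y) = 0 :=
    image_eq_zero_of_notMem_tsupport fun h => hy ⟨_, h, rfl⟩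
  have hmeas : Measurable fun p : X × X => (g p : ℝ≥0∞) :=
    (hgs.measurable_of_prod hg).coe_nnreal_ennreal
  have h1 (x : X) : ∫⁻ y, g (x, y) ∂μ = ∫⁻ y in V, g (x, y) ∂μ :=
    (setLIntegral_eq_of_support_subset (by
      intro y hy; by_contra h; simp [h0V h] at hy)).symm
  have h2 (y : X) : ∫⁻ x, g (x, y) ∂ν = ∫⁻ x in U, g (x, y) ∂ν :=
    (setLIntegral_eq_of_support_subset (by
      intro y hy; by_contra h; simp [h0U h] at hy)).symm
  have h3 : ∫⁻ x, ∫⁻ y in V, g (x, y) ∂μ ∂ν = ∫⁻ x in U, ∫⁻ y in V, g (x, y) ∂μ ∂ν :=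
    (setLIntegral_eq_of_support_subset (by
      intro y hy; by_contra h; simp [h0U h] at hy)).symm
  have h4 : ∫⁻ y, ∫⁻ x in U, g (x, y) ∂ν ∂μ = ∫⁻ y in V, ∫⁻ x in U, g (x, y) ∂ν ∂μ :=
    (setLIntegral_eq_of_support_subset (by
      intro y hy; by_contra h; simp [h0V h] at hy)).symm
  simp_rw [h1, h2]
  rw [h3, h4]
  exact lintegral_lintegral_swap hmeas.aemeasurable

theorem energy_le_swap {κ : X → X → ℝ≥0∞} (hker : IsKernel κ) (μ ν : Measure X)
    [μ.InnerRegular] [ν.InnerRegular] [IsFiniteMeasureOnCompacts μ]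
    [IsFiniteMeasureOnCompacts ν] : energy κ ν μ ≤ energy κ μ ν := by
  refine le_of_forall_lt fun b hb => ?_
  let G := {g : X × X → ℝ≥0 // Continuous g ∧ HasCompactSupport g ∧
    ∀ p, (g p : ℝ≥0∞) ≤ Function.uncurry κ p}
  have : Nonempty G := ⟨⟨fun _ => 0, continuous_const, HasCompactSupport.zero, by simp⟩⟩
  have : IsDirectedOrder G := ⟨fun g h => by
    refine ⟨⟨fun x => max (g.1 x) (h.1 x), g.2.1.max h.2.1, ?_, fun x => ?_⟩,
      fun x => le_max_left _ _, fun x => le_max_right _ _⟩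
    · refine HasCompactSupport.intro (g.2.2.1.isCompact.union h.2.2.1.isCompact) fun x hx => ?_
      rw [Set.mem_union, not_or] at hx
      simp [image_eq_zero_of_notMem_tsupport hx.1, image_eq_zero_of_notMem_tsupport hx.2]
    · rw [ENNReal.coe_max]
      exact max_le (g.2.2.2 x) (h.2.2.2 x)⟩
  have hker_lt (c : ℝ≥0) (x y : X) (h : (c : ℝ≥0∞) < κ x y) :
      ∃ V ∈ 𝓝 y, ∃ U ∈ 𝓝 x, ∀ᶠ g : G in atTop, ∀ x' ∈ U, ∀ y' ∈ V,
        (c : ℝ≥0∞) < g.1 (x', y') := by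
    borelize (X × X)
    have := innerRegular_dirac (x, y)
    obtain ⟨g, hg, hgs, hgf, hcg⟩ := exists_continuous_le_lt_lintegral hker.lsc
      (Measure.dirac (x, y)) (b := c) (by
        rw [lintegral_dirac]; exact h)
    rw [lintegral_dirac, ENNReal.coe_lt_coe] at hcg
    have h1 := hg.continuousAt.eventually (lt_mem_nhds hcg)
    rw [nhds_prod_eq, Filter.eventually_prod_iff] at h1
    obtain ⟨p, hp, q, hq, h⟩ := h1
    refine ⟨{y | q y}, hq, {x | p x}, hp, ?_⟩
    filter_upwards [eventually_ge_atTop (⟨g, hg, hgs, hgf⟩ : G)] with k hk x' hx' y' hy'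
    exact ENNReal.coe_lt_coe.2 ((h hx' hy').trans_le (hk _))
  have h1 := Balayage.eventually_lt_lintegral (lowerSemicontinuous_pot hker μ) (ν := ν)
    (l := (atTop : Filter G)) (F := fun g x => ∫⁻ y, g.1 (x, y) ∂μ) (m := fun _ => ν)
    (fun g _ _ b hb => Eventually.of_forall fun _ => hb) (fun c x hcx => by
      have h2 := Balayage.eventually_lt_lintegral (hker.lowerSemicontinuous_right x) (ν := μ)
        (l := 𝓝 x ×ˢ (atTop : Filter G)) (F := fun p y => p.2.1 (p.1, y)) (m := fun _ => μ)
        (fun g _ _ b hb => Eventually.of_forall fun _ => hb) (fun c y hcy => by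
          obtain ⟨V, hV, U, hU, hUV⟩ := hker_lt c x y hcy
          refine ⟨V, hV, ?_⟩
          filter_upwards [prod_mem_prod hU hUV] with p hp y hy using hp.2 _ hp.1 _ hy) hcx
      rw [Filter.eventually_prod_iff] at h2
      obtain ⟨p, hp, q, hq, h⟩ := h2
      exact ⟨{x | p x}, hp, hq.mono fun i hi y hy => h hy hi⟩) hb
  obtain ⟨g, hg⟩ := h1.exists
  refine hg.trans_le ?_
  rw [lintegral_lintegral_swap_of_hasCompactSupport g.2.1 g.2.2.1]
  refine lintegral_mono fun y => lintegral_mono fun x => ?_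
  rw [hker.symm]
  exact g.2.2.2 (x, y)

theorem energy_comm {κ : X → X → ℝ≥0∞} (hker : IsKernel κ) {μ ν : Measure X}
    (hμ : IsRadon μ) (hν : IsRadon ν) : energy κ μ ν = energy κ ν μ := by
  have := hμ.1
  have := hμ.2
  have := hν.1
  have := hν.2
  exact le_antisymm (energy_le_swap hker ν μ) (energy_le_swap hker μ ν)

/-- A regular measure can be replaced by a Radon measure (inner regular on all Borel sets)
without changing the integrals of compactly supported continuous functions. -/
theorem exists_isRadon_integral_eq (μ : Measure X) [μ.Regular] :
    ∃ ν : Measure X, IsRadon ν ∧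
      ∀ f : X → ℝ, HasCompactSupport f → ∫ x, f x ∂ν = ∫ x, f x ∂μ := by
  have hmono (s : Set X) : Monotone fun K : TopologicalSpace.Compacts X => μ (s ∩ K) :=
    fun K L hKL => measure_mono (inter_subset_inter_right _ hKL)
  let ν : Measure X := Measure.ofMeasurable
    (fun s _ => ⨆ K : TopologicalSpace.Compacts X, μ (s ∩ K)) (by simp) (fun f hf hd => by
      have h1 (K : TopologicalSpace.Compacts X) :
          μ ((⋃ i, f i) ∩ K) = ⨆ s : Finset ℕ, ∑ i ∈ s, μ (f i ∩ K) := by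
        rw [iUnion_inter, measure_iUnion (fun i j hij => (hd hij).mono inter_subset_left
          inter_subset_left) (fun i => (hf i).inter K.isCompact.measurableSet),
          ENNReal.tsum_eq_iSup_sum]
      simp_rw [h1]
      rw [iSup_comm, ENNReal.tsum_eq_iSup_sum]
      exact iSup_congr fun s => (ENNReal.finsetSum_iSup_of_monotone fun i => hmono (f i)).symm)
  have hν (s : Set X) (hs : MeasurableSet s) :
      ν s = ⨆ K : TopologicalSpace.Compacts X, μ (s ∩ K) := Measure.ofMeasurable_apply s hs
  have hνK (s K : Set X) (hs : MeasurableSet s) (hK : IsCompact K) : ν (s ∩ K) = μ (s ∩ K) := by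
    rw [hν _ (hs.inter hK.measurableSet)]
    refine le_antisymm (iSup_le fun L => measure_mono inter_subset_left) ?_
    refine le_trans (measure_mono ?_)
      (le_iSup (fun L : TopologicalSpace.Compacts X => μ (s ∩ K ∩ L)) ⟨K, hK⟩)
    exact fun x hx => ⟨hx, hx.2⟩
  refine ⟨ν, ⟨⟨fun U hU r hr => ?_⟩, ⟨fun x => ?_⟩⟩, fun f hf => ?_⟩
  · rw [hν U hU, lt_iSup_iff] at hr
    obtain ⟨K, hK⟩ := hr
    obtain ⟨L, hLU, hL, hrL⟩ := (hU.inter K.isCompact.measurableSet).exists_lt_isCompact_of_ne_top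
      ((measure_mono inter_subset_right).trans_lt K.isCompact.measure_lt_top).ne hK
    refine ⟨L, hLU.trans inter_subset_left, hL, ?_⟩
    have := hνK univ L MeasurableSet.univ hL
    rw [univ_inter] at this
    rwa [this]
  · obtain ⟨K, hK, hKx⟩ := exists_compact_mem_nhds x
    refine ⟨K, hKx, ?_⟩
    have := hνK univ K MeasurableSet.univ hK
    rw [univ_inter] at this
    rw [this]
    exact hK.measure_lt_top
  · have h0 : ∀ x, x ∉ tsupport f → f x = 0 := fun x => image_eq_zero_of_notMem_tsupport
    rw [← setIntegral_eq_integral_of_forall_compl_eq_zero (μ := ν) h0,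
      ← setIntegral_eq_integral_of_forall_compl_eq_zero (μ := μ) h0]
    have hr : ν.restrict (tsupport f) = μ.restrict (tsupport f) := by
      ext s hs
      rw [Measure.restrict_apply hs, Measure.restrict_apply hs, hνK s _ hs hf.isCompact]
    rw [hr]

/-- A sequence of Radon measures that is bounded on compact sets has a vague limit along every
ultrafilter. -/
theorem exists_vagueConv (G : Ultrafilter ℕ) {m : ℕ → Measure X} (hm : ∀ n, IsRadon (m n))
    (hb : ∀ K : Set X, IsCompact K → ∃ C : ℝ≥0, ∀ n, m n K ≤ C) :
    ∃ ν : Measure X, IsRadon ν ∧ VagueConv (G : Filter ℕ) m ν := by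
  have hfin (n : ℕ) : IsLocallyFiniteMeasure (m n) := (hm n).2
  have hlim (f : CompactlySupportedContinuousMap X ℝ) :
      ∃ L : ℝ, Tendsto (fun n => ∫ x, f x ∂(m n)) (G : Filter ℕ) (𝓝 L) := by
    obtain ⟨C, hC⟩ := hb _ f.hasCompactSupport.isCompact
    obtain ⟨D, hD⟩ := f.hasCompactSupport.exists_bound_of_continuous f.continuous
    have h1 (n : ℕ) : ∫ x, f x ∂(m n) ∈ Icc (-(|D| * C)) (|D| * C) := by
      rw [mem_Icc, ← abs_le, ← Real.norm_eq_abs,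
        ← setIntegral_eq_integral_of_forall_compl_eq_zero (s := tsupport f)
          (fun x => image_eq_zero_of_notMem_tsupport)]
      have hlt : m n (tsupport f) < ∞ := f.hasCompactSupport.isCompact.measure_lt_top
      refine (norm_setIntegral_le_of_norm_le_const hlt
        fun x _ => (hD x).trans (le_abs_self D)).trans ?_
      refine mul_le_mul_of_nonneg_left ?_ (abs_nonneg D)
      exact ENNReal.toReal_le_of_le_ofReal C.2 (by simpa using hC n)
    obtain ⟨L, -, hL⟩ := isCompact_Icc.ultrafilter_le_nhds
      (G.map fun n => ∫ x, f x ∂(m n)) (le_principal_iff.2 (mem_map.2 (univ_mem' h1)))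
    exact ⟨L, hL⟩
  choose L hL using hlim
  have hint (n : ℕ) (f : CompactlySupportedContinuousMap X ℝ) : Integrable f (m n) :=
    f.continuous.integrable_of_hasCompactSupport f.hasCompactSupport
  let Λ : CompactlySupportedContinuousMap X ℝ →ₗ[ℝ] ℝ :=
    { toFun := L
      map_add' := fun f g => by
        refine tendsto_nhds_unique (hL (f + g)) (((hL f).add (hL g)).congr fun n => ?_)
        exact (integral_add (hint n f) (hint n g)).symm
      map_smul' := fun c f => by
        refine tendsto_nhds_unique (hL (c • f)) (((hL f).const_smul c).congr fun n => ?_)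
        exact (integral_smul c f).symm }
  let Λp : CompactlySupportedContinuousMap X ℝ →ₚ[ℝ] ℝ := PositiveLinearMap.mk₀ Λ fun f hf =>
    ge_of_tendsto (hL f) (Eventually.of_forall fun n => integral_nonneg fun x => hf x)
  obtain ⟨ν, hν, hνf⟩ := exists_isRadon_integral_eq (RealRMK.rieszMeasure Λp)
  refine ⟨ν, hν, fun f hf hfs => ?_⟩
  rw [hνf f hfs]
  have := RealRMK.integral_rieszMeasure Λp ⟨⟨f, hf⟩, hfs⟩
  exact (hL ⟨⟨f, hf⟩, hfs⟩).trans_eq (congrArg 𝓝 this.symm)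

theorem isRadon_dirac (x : X) : IsRadon (Measure.dirac x) :=
  ⟨innerRegular_dirac x, inferInstance⟩

theorem isRadon_zero : IsRadon (0 : Measure X) := ⟨inferInstance, inferInstance⟩

theorem zero_mem_Eplus (κ : X → X → ℝ≥0∞) : (0 : Measure X) ∈ Eplus κ :=
  ⟨isRadon_zero, by simp [energy]⟩

theorem EnergyPrinciple.diag_pos {κ : X → X → ℝ≥0∞} (hker : IsKernel κ)
    (hE : EnergyPrinciple κ) (x : X) : 0 < κ x x := by
  rw [pos_iff_ne_zero]
  intro h0
  have h1 : pot κ (Measure.dirac x) x = 0 := by simp [pot, h0]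
  have h2 : energy κ (Measure.dirac x) (Measure.dirac x) = 0 := by
    have := innerRegular_dirac x
    rw [energy, lintegral_dirac' _ (measurable_pot hker _), h1]
  have h3 := (hE _ ⟨isRadon_dirac x, by simp [h2]⟩ _ (zero_mem_Eplus κ)).2 (by
    rw [h2]; simp [energy, pot])
  exact (Measure.dirac_ne_zero (a := x)) h3

/-- Measures of bounded energy are bounded on compact sets. -/
theorem exists_measure_le {κ : X → X → ℝ≥0∞} (hker : IsKernel κ) (hE : EnergyPrinciple κ)
    (M : ℝ≥0) {K : Set X} (hK : IsCompact K) :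
    ∃ C : ℝ≥0, ∀ μ : Measure X, energy κ μ μ ≤ M → μ K ≤ C := by
  refine hK.induction_on (p := fun K => ∃ C : ℝ≥0, ∀ μ : Measure X, energy κ μ μ ≤ M → μ K ≤ C)
    ⟨0, by simp⟩ (fun S T hST ⟨C, hC⟩ => ⟨C, fun μ hμ => (measure_mono hST).trans (hC μ hμ)⟩)
    (fun S T ⟨C, hC⟩ ⟨D, hD⟩ => ⟨C + D, fun μ hμ => ?_⟩) (fun x _ => ?_)
  · rw [ENNReal.coe_add]
    exact (measure_union_le _ _).trans (add_le_add (hC μ hμ) (hD μ hμ))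
  · obtain ⟨c, hc0, hc⟩ := ENNReal.lt_iff_exists_nnreal_btwn.1 (hE.diag_pos hker x)
    obtain ⟨V, hV, U, hU, hUV⟩ := hker.eventually_lt hc
    obtain ⟨W, hWUV, hW, hxW⟩ := mem_nhds_iff.1 (inter_mem hU hV)
    refine ⟨W, mem_nhdsWithin_of_mem_nhds (hW.mem_nhds hxW), max 1 (M / c), fun μ hμ => ?_⟩
    have hc0' : c ≠ 0 := by rintro rfl; simp at hc0
    have h1 : c * μ W * μ W ≤ M := by
      calc c * μ W * μ W = ∫⁻ x in W, ∫⁻ y in W, c ∂μ ∂μ := by simp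
        _ ≤ ∫⁻ x in W, ∫⁻ y in W, κ x y ∂μ ∂μ :=
          setLIntegral_mono' hW.measurableSet fun x hx =>
            setLIntegral_mono' hW.measurableSet fun y hy =>
              (hUV x (hWUV hx).1 y (hWUV hy).2).le
        _ ≤ ∫⁻ x, ∫⁻ y, κ x y ∂μ ∂μ := (setLIntegral_le_lintegral _ _).trans
          (lintegral_mono fun x => setLIntegral_le_lintegral _ _)
        _ ≤ M := hμ
    by_cases h : μ W ≤ 1
    · exact h.trans (by exact_mod_cast le_max_left _ _)
    · push Not at h
      refine le_trans ?_ (ENNReal.coe_le_coe.2 (le_max_right 1 (M / c)))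
      rw [ENNReal.coe_div hc0', ENNReal.le_div_iff_mul_le (by simp [hc0']) (by simp)]
      calc μ W * c = c * μ W * 1 := by ring
        _ ≤ c * μ W * μ W := by gcongr
        _ ≤ M := h1

/-- The mutual energy as a real number. -/
noncomputable def realEnergy (κ : X → X → ℝ≥0∞) (μ ν : Measure X) : ℝ := (energy κ μ ν).toReal

/-- The squared strong distance. -/
noncomputable def sqDist (κ : X → X → ℝ≥0∞) (μ ν : Measure X) : ℝ :=
  realEnergy κ μ μ - 2 * realEnergy κ μ ν + realEnergy κ ν ν

theorem strDist_eq_sqrt (κ : X → X → ℝ≥0∞) (μ ν : Measure X) :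
    strDist κ μ ν = Real.sqrt (sqDist κ μ ν) := rfl

section Energy

variable {κ : X → X → ℝ≥0∞} {μ ν ρ τ : Measure X}

theorem energy_ne_top (hE : EnergyPrinciple κ) (hμ : μ ∈ Eplus κ) (hν : ν ∈ Eplus κ) :
    energy κ μ ν ≠ ⊤ := by
  have h1 := (hE μ hμ ν hν).1.trans_lt (ENNReal.add_lt_top.2 ⟨hμ.2, hν.2⟩)
  exact (ENNReal.lt_top_of_mul_ne_top_right h1.ne two_ne_zero).ne

theorem realEnergy_comm (hker : IsKernel κ) (hμ : μ ∈ Eplus κ) (hν : ν ∈ Eplus κ) :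
    realEnergy κ μ ν = realEnergy κ ν μ := by
  rw [realEnergy, energy_comm hker hμ.1 hν.1, realEnergy]

theorem sqDist_nonneg (hE : EnergyPrinciple κ) (hμ : μ ∈ Eplus κ) (hν : ν ∈ Eplus κ) :
    0 ≤ sqDist κ μ ν := by
  have h1 := ENNReal.toReal_mono (ENNReal.add_ne_top.2 ⟨hμ.2.ne, hν.2.ne⟩) (hE μ hμ ν hν).1
  rw [ENNReal.toReal_add hμ.2.ne hν.2.ne, ENNReal.toReal_mul] at h1
  simp only [sqDist, realEnergy]
  norm_num at h1
  linarith

theorem eq_of_sqDist_eq_zero (hE : EnergyPrinciple κ) (hμ : μ ∈ Eplus κ) (hν : ν ∈ Eplus κ)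
    (h : sqDist κ μ ν = 0) : μ = ν := by
  refine (hE μ hμ ν hν).2 ?_
  have h1 := energy_ne_top hE hμ hν
  rw [← ENNReal.toReal_eq_toReal_iff' (ENNReal.mul_ne_top (by simp) h1)
    (ENNReal.add_ne_top.2 ⟨hμ.2.ne, hν.2.ne⟩), ENNReal.toReal_add hμ.2.ne hν.2.ne,
    ENNReal.toReal_mul]
  simp only [sqDist, realEnergy] at h
  norm_num
  linarith

theorem energy_add_left (κ : X → X → ℝ≥0∞) (μ ν ρ : Measure X) :
    energy κ (μ + ν) ρ = energy κ μ ρ + energy κ ν ρ := lintegral_add_measure _ _ _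

theorem energy_smul_left (κ : X → X → ℝ≥0∞) (c : ℝ≥0) (μ ρ : Measure X) :
    energy κ (c • μ) ρ = c * energy κ μ ρ := by
  simp only [energy]
  rw [lintegral_smul_measure]
  rfl

theorem IsRadon.add (hμ : IsRadon μ) (hν : IsRadon ν) : IsRadon (μ + ν) := by
  have := hμ.1
  have := hμ.2
  have := hν.1
  have := hν.2
  refine ⟨inferInstance, ⟨fun x => ?_⟩⟩
  obtain ⟨K, hK, hxK⟩ := exists_compact_mem_nhds x
  exact ⟨K, hxK, ENNReal.add_lt_top.2 ⟨hK.measure_lt_top, hK.measure_lt_top⟩⟩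

theorem IsRadon.smul (hμ : IsRadon μ) (c : ℝ≥0) : IsRadon (c • μ) := by
  have := hμ.1
  have := hμ.2
  exact ⟨inferInstance, inferInstance⟩

theorem energy_add_right (hker : IsKernel κ) (hμ : IsRadon μ) (hν : IsRadon ν) (hρ : IsRadon ρ) :
    energy κ ρ (μ + ν) = energy κ ρ μ + energy κ ρ ν := by
  rw [energy_comm hker hρ (hμ.add hν), energy_add_left, energy_comm hker hμ hρ,
    energy_comm hker hν hρ]

theorem energy_smul_right (hker : IsKernel κ) (c : ℝ≥0) (hμ : IsRadon μ) (hρ : IsRadon ρ) :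
    energy κ ρ (c • μ) = c * energy κ ρ μ := by
  rw [energy_comm hker hρ (hμ.smul c), energy_smul_left, energy_comm hker hμ hρ]

theorem add_mem_Eplus (hker : IsKernel κ) (hE : EnergyPrinciple κ) (hμ : μ ∈ Eplus κ)
    (hν : ν ∈ Eplus κ) : μ + ν ∈ Eplus κ := by
  refine ⟨hμ.1.add hν.1, ?_⟩
  rw [energy_add_left, energy_add_right hker hμ.1 hν.1 hμ.1,
    energy_add_right hker hμ.1 hν.1 hν.1]
  have h1 := energy_ne_top hE hμ hν
  have h2 := energy_ne_top hE hν hμ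
  exact (ENNReal.add_ne_top.2 ⟨ENNReal.add_ne_top.2 ⟨hμ.2.ne, h1⟩,
    ENNReal.add_ne_top.2 ⟨h2, hν.2.ne⟩⟩).lt_top

theorem smul_mem_Eplus (hker : IsKernel κ) (c : ℝ≥0) (hμ : μ ∈ Eplus κ) : c • μ ∈ Eplus κ := by
  refine ⟨hμ.1.smul c, ?_⟩
  rw [energy_smul_left, energy_smul_right hker c hμ.1 hμ.1]
  exact ENNReal.mul_lt_top (by simp) (ENNReal.mul_lt_top (by simp) hμ.2)

theorem realEnergy_add_left (hE : EnergyPrinciple κ) (hμ : μ ∈ Eplus κ) (hν : ν ∈ Eplus κ)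
    (hρ : ρ ∈ Eplus κ) :
    realEnergy κ (μ + ν) ρ = realEnergy κ μ ρ + realEnergy κ ν ρ := by
  rw [realEnergy, energy_add_left, ENNReal.toReal_add (energy_ne_top hE hμ hρ)
    (energy_ne_top hE hν hρ)]
  rfl

theorem realEnergy_add_right (hker : IsKernel κ) (hE : EnergyPrinciple κ) (hμ : μ ∈ Eplus κ)
    (hν : ν ∈ Eplus κ) (hρ : ρ ∈ Eplus κ) :
    realEnergy κ ρ (μ + ν) = realEnergy κ ρ μ + realEnergy κ ρ ν := by
  rw [realEnergy, energy_add_right hker hμ.1 hν.1 hρ.1,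
    ENNReal.toReal_add (energy_ne_top hE hρ hμ) (energy_ne_top hE hρ hν)]
  rfl

theorem realEnergy_smul_left (κ : X → X → ℝ≥0∞) (c : ℝ≥0) (μ ρ : Measure X) :
    realEnergy κ (c • μ) ρ = c * realEnergy κ μ ρ := by
  rw [realEnergy, energy_smul_left, ENNReal.toReal_mul]
  rfl

theorem realEnergy_smul_right (hker : IsKernel κ) (c : ℝ≥0) (hμ : μ ∈ Eplus κ)
    (hρ : ρ ∈ Eplus κ) : realEnergy κ ρ (c • μ) = c * realEnergy κ ρ μ := by
  rw [realEnergy, energy_smul_right hker c hμ.1 hρ.1, ENNReal.toReal_mul]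
  rfl

theorem sqDist_smul_right (hker : IsKernel κ) (c : ℝ≥0) (hμ : μ ∈ Eplus κ) (hν : ν ∈ Eplus κ) :
    sqDist κ μ (c • ν) =
      realEnergy κ μ μ - 2 * c * realEnergy κ μ ν + c ^ 2 * realEnergy κ ν ν := by
  rw [sqDist, realEnergy_smul_right hker c hν hμ, realEnergy_smul_left,
    realEnergy_smul_right hker c hν hν]
  ring

theorem sqDist_add_smul_right (hker : IsKernel κ) (hE : EnergyPrinciple κ) (c : ℝ≥0)
    (hμ : μ ∈ Eplus κ) (hν : ν ∈ Eplus κ) (hτ : τ ∈ Eplus κ) :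
    sqDist κ μ (ν + c • τ) = sqDist κ μ ν +
      2 * c * (realEnergy κ ν τ - realEnergy κ μ τ) + c ^ 2 * realEnergy κ τ τ := by
  have hcτ := smul_mem_Eplus hker c hτ
  have hs := add_mem_Eplus hker hE hν hcτ
  rw [sqDist, sqDist, realEnergy_add_left hE hν hcτ hs, realEnergy_add_right hker hE hν hcτ hμ,
    realEnergy_add_right hker hE hν hcτ hν, realEnergy_add_right hker hE hν hcτ hcτ,
    realEnergy_smul_left, realEnergy_smul_left, realEnergy_smul_right hker c hτ hμ,
    realEnergy_smul_right hker c hτ hν, realEnergy_smul_right hker c hτ hτ,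
    realEnergy_comm hker hτ hν]
  ring

theorem sqDist_comm (hker : IsKernel κ) (hμ : μ ∈ Eplus κ) (hν : ν ∈ Eplus κ) :
    sqDist κ μ ν = sqDist κ ν μ := by
  rw [sqDist, sqDist, realEnergy_comm hker hμ hν]
  ring

/-- The parallelogram identity. -/
theorem sqDist_eq_parallelogram (hker : IsKernel κ) (hE : EnergyPrinciple κ) (hμ : μ ∈ Eplus κ)
    (hν : ν ∈ Eplus κ) (hτ : τ ∈ Eplus κ) :
    sqDist κ ν τ = 2 * sqDist κ μ ν + 2 * sqDist κ μ τ -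
      4 * sqDist κ μ ((1 / 2 : ℝ≥0) • (ν + (1 : ℝ≥0) • τ)) := by
  have h1 : realEnergy κ μ (ν + (1 : ℝ≥0) • τ) = realEnergy κ μ ν + realEnergy κ μ τ := by
    rw [one_smul, realEnergy_add_right hker hE hν hτ hμ]
  have h2 := sqDist_add_smul_right hker hE 1 (zero_mem_Eplus κ) hν hτ
  have h0 (ρ : Measure X) : realEnergy κ 0 ρ = 0 := by simp [realEnergy, energy]
  have hs := add_mem_Eplus hker hE hν (smul_mem_Eplus hker 1 hτ)
  rw [sqDist_smul_right hker _ hμ hs, h1]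
  simp only [sqDist, h0] at h2 ⊢
  push_cast at h2 ⊢
  linarith

/-- The Cauchy-Schwarz inequality. -/
theorem sq_realEnergy_sub_le (hker : IsKernel κ) (hE : EnergyPrinciple κ) (hμ : μ ∈ Eplus κ)
    (hν : ν ∈ Eplus κ) (hτ : τ ∈ Eplus κ) :
    (realEnergy κ μ τ - realEnergy κ ν τ) ^ 2 ≤ sqDist κ μ ν * realEnergy κ τ τ := by
  have h1 (t : ℝ) : 0 ≤ realEnergy κ τ τ * (t * t) +
      2 * (realEnergy κ μ τ - realEnergy κ ν τ) * t + sqDist κ μ ν := by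
    rcases le_total 0 t with ht | ht
    · lift t to ℝ≥0 using ht
      have h2 := sqDist_add_smul_right hker hE t hν hμ hτ
      have h3 := sqDist_nonneg hE hν (add_mem_Eplus hker hE hμ (smul_mem_Eplus hker t hτ))
      rw [sqDist_comm hker hμ hν]
      nlinarith
    · obtain ⟨s, rfl⟩ : ∃ s : ℝ≥0, t = -s := 
        ⟨Real.toNNReal (-t), by rw [Real.coe_toNNReal _ (by linarith)]; ring⟩
      have h2 := sqDist_add_smul_right hker hE s hμ hν hτ
      have h3 := sqDist_nonneg hE hμ (add_mem_Eplus hker hE hν (smul_mem_Eplus hker s hτ))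
      nlinarith
  have h2 := discrim_le_zero h1
  rw [discrim] at h2
  nlinarith

theorem tendsto_realEnergy (hker : IsKernel κ) (hE : EnergyPrinciple κ) {m : ℕ → Measure X}
    (hm : ∀ n, m n ∈ Eplus κ) (hν : ν ∈ Eplus κ)
    (h : Tendsto (fun n => sqDist κ (m n) ν) atTop (𝓝 0)) (hτ : τ ∈ Eplus κ) :
    Tendsto (fun n => realEnergy κ (m n) τ) atTop (𝓝 (realEnergy κ ν τ)) := by
  rw [← tendsto_sub_nhds_zero_iff]
  refine squeeze_zero_norm (a := fun n => Real.sqrt (sqDist κ (m n) ν * realEnergy κ τ τ))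
    (fun n => ?_) ?_
  · exact Real.abs_le_sqrt (sq_realEnergy_sub_le hker hE (hm n) hν hτ)
  · simpa using (h.mul_const (realEnergy κ τ τ)).sqrt

theorem tendsto_realEnergy_self (hker : IsKernel κ) (hE : EnergyPrinciple κ)
    {m : ℕ → Measure X} (hm : ∀ n, m n ∈ Eplus κ) (hν : ν ∈ Eplus κ)
    (h : Tendsto (fun n => sqDist κ (m n) ν) atTop (𝓝 0)) :
    Tendsto (fun n => realEnergy κ (m n) (m n)) atTop (𝓝 (realEnergy κ ν ν)) := by
  have h1 := tendsto_realEnergy hker hE hm hν h hν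
  have h2 := (h.add (h1.const_mul 2)).sub_const (realEnergy κ ν ν)
  convert h2 using 2
  · simp only [sqDist]; ring
  · ring

theorem tendsto_sqDist (hker : IsKernel κ) (hE : EnergyPrinciple κ)
    {m : ℕ → Measure X} (hm : ∀ n, m n ∈ Eplus κ) (hν : ν ∈ Eplus κ)
    (h : Tendsto (fun n => sqDist κ (m n) ν) atTop (𝓝 0)) (hμ : μ ∈ Eplus κ) :
    Tendsto (fun n => sqDist κ μ (m n)) atTop (𝓝 (sqDist κ μ ν)) := by
  have h1 := tendsto_realEnergy hker hE hm hν h hμ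
  have h2 := ((h1.const_mul 2).const_sub (realEnergy κ μ μ)).add
    (tendsto_realEnergy_self hker hE hm hν h)
  simp_rw [realEnergy_comm hker (hm _) hμ, realEnergy_comm hker hν hμ] at h2
  exact h2

/-- Strong completeness: a strong Cauchy sequence converges strongly, and vaguely along some
ultrafilter, to the same measure of finite energy. -/
theorem exists_strong_limit (hker : IsKernel κ) (hE : EnergyPrinciple κ) (hC : Consistent κ)
    {m : ℕ → Measure X} (hm : ∀ n, m n ∈ Eplus κ) {M : ℝ}
    (hM : ∀ n, realEnergy κ (m n) (m n) ≤ M)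
    (hcau : ∀ ε : ℝ, 0 < ε → ∃ N, ∀ i ≥ N, ∀ j ≥ N, sqDist κ (m i) (m j) < ε) :
    ∃ ν ∈ Eplus κ, Tendsto (fun n => sqDist κ (m n) ν) atTop (𝓝 0) ∧
      ∃ G : Ultrafilter ℕ, VagueConv (G : Filter ℕ) m ν := by
  have hM' (n : ℕ) : energy κ (m n) (m n) ≤ M.toNNReal := by
    rw [← ENNReal.ofReal_toReal (hm n).2.ne]
    exact ENNReal.ofReal_le_ofReal (hM n)
  obtain ⟨ν, hν, hG⟩ := exists_vagueConv (hyperfilter ℕ) (fun n => (hm n).1) fun K hK =>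
    (exists_measure_le hker hE M.toNNReal hK).imp fun C hC n => hC _ (hM' n)
  have hle : (hyperfilter ℕ : Filter ℕ) ≤ atTop := Nat.hyperfilter_le_atTop
  have hνE : energy κ ν ν ≤ M.toNNReal := by
    by_contra! hcon
    have := hν.1
    have := hν.2
    have hfin (n : ℕ) : IsFiniteMeasureOnCompacts (m n) := by
      have := (hm n).1.2
      infer_instance
    obtain ⟨n, hn⟩ := (eventually_lt_energy hker (hG.eventually_lt_lintegral hfin) hcon).exists
    exact hn.not_ge (hM' n)
  refine ⟨ν, ⟨hν, hνE.trans_lt (by simp)⟩, ?_, _, hG⟩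
  have h1 := hC ℕ atTop m inferInstance hm (fun ε hε => by
    obtain ⟨N, hN⟩ := hcau (ε ^ 2) (by positivity)
    refine ⟨Ici N, mem_atTop N, fun i hi j hj => ?_⟩
    rw [strDist_eq_sqrt, Real.sqrt_lt' hε]
    exact hN i hi j hj) ν ⟨_, hle, inferInstance, hG⟩
  have h2 := h1.pow 2
  simp_rw [strDist_eq_sqrt, Real.sq_sqrt (sqDist_nonneg hE (hm _)
    ⟨hν, hνE.trans_lt (by simp)⟩)] at h2
  simpa using h2

end Energy

section Concentration

variable {κ : X → X → ℝ≥0∞} {A : Set X} {μ ν ρ τ : Measure X} {P : X → Prop}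

theorem restrict_mem_Eplus (hτ : τ ∈ Eplus κ) {L : Set X} (hL : IsCompact L) :
    τ.restrict L ∈ Eplus κ := by
  have := hτ.1.1
  have := hτ.1.2
  have : IsFiniteMeasure (τ.restrict L) := isFiniteMeasure_restrict.2 hL.measure_lt_top.ne
  refine ⟨⟨inferInstance, inferInstance⟩, lt_of_le_of_lt ?_ hτ.2⟩
  exact lintegral_mono' Measure.restrict_le_self
    fun x => lintegral_mono' Measure.restrict_le_self le_rfl

/-- A Borel set meeting `A` in positive measure contains a compact subset of `A` of
positive measure, for a Radon measure carried by `A`. -/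
theorem exists_isCompact_pos (hτ : τ.InnerRegular) (hA : τ Aᶜ = 0) {B : Set X}
    (hB : MeasurableSet B) (h : τ B ≠ 0) : ∃ K ⊆ B ∩ A, IsCompact K ∧ 0 < τ K := by
  have h1 : τ (B \ toMeasurable τ Aᶜ) = τ B := measure_sdiff_null (by rwa [measure_toMeasurable])
  obtain ⟨K, hKB, hK, hpos⟩ := (hB.diff (measurableSet_toMeasurable τ Aᶜ)).exists_lt_isCompact
    (μ := τ) (r := 0) (by rw [h1]; exact pos_iff_ne_zero.2 h)
  exact ⟨K, fun x hx => ⟨(hKB hx).1, by_contra fun hxA =>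
    (hKB hx).2 (subset_toMeasurable τ Aᶜ hxA)⟩, hK, hpos⟩

theorem ConcOn.measure_compl (h : ConcOn τ A) (hτ : τ.InnerRegular) : τ Aᶜ = 0 := by
  obtain ⟨t, htA, ht, hae⟩ := h.1.compl.exists_measurable_subset_ae_eq
  rw [← measure_congr hae]
  by_contra h0
  obtain ⟨K, hKt, hK, hpos⟩ := ht.exists_lt_isCompact (μ := τ) (r := 0) (pos_iff_ne_zero.2 h0)
  refine hpos.ne' (measure_mono_null ?_ (h.2 K hK))
  exact subset_inter (hKt.trans htA) Subset.rfl

theorem concOn_of_measure_compl (h : τ Aᶜ = 0) : ConcOn τ A :=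
  ⟨(NullMeasurableSet.of_null h).of_compl, fun _ _ => measure_mono_null inter_subset_left h⟩

/-- Potentials are compared almost everywhere by testing on restrictions to compact sets. -/
theorem ae_pot_le (hker : IsKernel κ) (hE : EnergyPrinciple κ) (hτ : τ ∈ Eplus κ)
    (hρ : ρ ∈ Eplus κ) (hν : ν ∈ Eplus κ) (hA : τ Aᶜ = 0)
    (h : ∀ L ⊆ A, IsCompact L → energy κ (τ.restrict L) ρ ≤ energy κ (τ.restrict L) ν) :
    ∀ᵐ x ∂τ, pot κ ρ x ≤ pot κ ν x := by
  have := hρ.1.1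
  have := hν.1.1
  by_contra hcon
  obtain ⟨K, hKB, hK, hpos⟩ := exists_isCompact_pos (B := {x | pot κ ν x < pot κ ρ x}) hτ.1.1 hA
    (measurableSet_lt (measurable_pot hker ν) (measurable_pot hker ρ))
    (by simpa [ae_iff] using hcon)
  have h1 : energy κ (τ.restrict K) ν < energy κ (τ.restrict K) ρ :=
    setLIntegral_strict_mono hK.measurableSet hpos.ne' (measurable_pot hker ρ)
      (energy_ne_top hE (restrict_mem_Eplus hτ hK) hν)
      (Eventually.of_forall fun x hx => (hKB hx).1)
  exact h1.not_ge (h K (hKB.trans inter_subset_right) hK)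

theorem innerCap_eq_zero_iff : innerCap κ A = 0 ↔ ∀ τ ∈ EplusOn κ A, τ univ ≠ 1 := by
  rw [innerCap, ENNReal.inv_eq_zero, iInf₂_eq_top]
  exact ⟨fun h τ hτ h1 => hτ.1.2.ne (h τ ⟨hτ, h1⟩), fun h τ hτ => absurd hτ.2 (h τ hτ.1)⟩

theorem NEOn.ae (hker : IsKernel κ) (h : NEOn κ A P) (hP : MeasurableSet {x | P x})
    (hτ : τ ∈ Eplus κ) (hA : τ Aᶜ = 0) : ∀ᵐ x ∂τ, P x := by
  by_contra hcon
  obtain ⟨K, hKB, hK, hpos⟩ := exists_isCompact_pos (B := {x | P x}ᶜ) hτ.1.1 hA hP.compl hcon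
  have := hτ.1.2
  have htop := hK.measure_lt_top (μ := τ)
  refine innerCap_eq_zero_iff.1 h ((τ K).toNNReal⁻¹ • τ.restrict K)
    ⟨smul_mem_Eplus hker _ (restrict_mem_Eplus hτ hK), concOn_of_measure_compl ?_⟩ ?_
  · have h1 : τ.restrict K {x | x ∈ A ∧ ¬ P x}ᶜ = 0 := by
      refine measure_mono_null (t := Kᶜ) (compl_subset_compl.2 fun x hx =>
        ⟨(hKB hx).2, (hKB hx).1⟩) ?_
      rw [Measure.restrict_apply hK.measurableSet.compl, compl_inter_self, measure_empty]
    rw [Measure.smul_apply, h1, smul_zero]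
  · rw [Measure.smul_apply, Measure.restrict_apply_univ, ENNReal.smul_def, smul_eq_mul,
      ENNReal.coe_inv (ENNReal.toNNReal_ne_zero.2 ⟨hpos.ne', htop.ne⟩),
      ENNReal.coe_toNNReal htop.ne, ENNReal.inv_mul_cancel hpos.ne' htop.ne]

theorem neOn_of_forall_ae
    (h : ∀ τ ∈ Eplus κ, τ {x | x ∈ A ∧ ¬ P x}ᶜ = 0 → ∀ᵐ x ∂τ, P x) : NEOn κ A P := by
  refine innerCap_eq_zero_iff.2 fun τ hτ h1 => ?_
  have h2 := hτ.2.measure_compl hτ.1.1.1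
  have h3 := h τ hτ.1 h2
  have h4 : τ univ = 0 := by
    refine measure_mono_null (fun x _ => ?_) (measure_union_null h2 h3)
    by_cases hx : x ∈ A ∧ ¬ P x
    · exact Or.inr hx.2
    · exact Or.inl hx
  simp [h4] at h1

/-- The measures of finite energy carried by a compact subset of `A`. -/
def compactCone (κ : X → X → ℝ≥0∞) (A : Set X) : Set (Measure X) :=
  {τ ∈ Eplus κ | ∃ K ⊆ A, IsCompact K ∧ τ Kᶜ = 0}

theorem measure_compl_of_mem_compactCone (h : τ ∈ compactCone κ A) : τ Aᶜ = 0 := by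
  obtain ⟨K, hKA, -, h0⟩ := h.2
  exact measure_mono_null (compl_subset_compl.2 hKA) h0

theorem compactCone_subset_EplusOn : compactCone κ A ⊆ EplusOn κ A := fun _ h =>
  ⟨h.1, concOn_of_measure_compl (measure_compl_of_mem_compactCone h)⟩

theorem zero_mem_compactCone : 0 ∈ compactCone κ A :=
  ⟨zero_mem_Eplus κ, ∅, empty_subset A, isCompact_empty, by simp⟩

theorem add_mem_compactCone (hker : IsKernel κ) (hE : EnergyPrinciple κ)
    (hμ : μ ∈ compactCone κ A) (hν : ν ∈ compactCone κ A) : μ + ν ∈ compactCone κ A := by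
  obtain ⟨K, hKA, hK, hK0⟩ := hμ.2
  obtain ⟨L, hLA, hL, hL0⟩ := hν.2
  refine ⟨add_mem_Eplus hker hE hμ.1 hν.1, K ∪ L, union_subset hKA hLA, hK.union hL, ?_⟩
  rw [compl_union, Measure.add_apply, measure_mono_null inter_subset_left hK0,
    measure_mono_null inter_subset_right hL0, add_zero]

theorem smul_mem_compactCone (hker : IsKernel κ) (c : ℝ≥0) (hμ : μ ∈ compactCone κ A) :
    c • μ ∈ compactCone κ A := by
  obtain ⟨K, hKA, hK, hK0⟩ := hμ.2
  exact ⟨smul_mem_Eplus hker c hμ.1, K, hKA, hK, by rw [Measure.smul_apply, hK0, smul_zero]⟩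

theorem restrict_mem_compactCone (hτ : τ ∈ Eplus κ) {L : Set X} (hL : IsCompact L)
    (hLA : L ⊆ A) : τ.restrict L ∈ compactCone κ A := by
  refine ⟨restrict_mem_Eplus hτ hL, L, hLA, hL, ?_⟩
  rw [Measure.restrict_apply hL.measurableSet.compl, compl_inter_self, measure_empty]

theorem energy_le_of_realEnergy_le (hker : IsKernel κ) (hE : EnergyPrinciple κ)
    (hμ : μ ∈ Eplus κ) (hν : ν ∈ Eplus κ) (hτ : τ ∈ Eplus κ)
    (h : realEnergy κ μ τ ≤ realEnergy κ ν τ) : energy κ τ μ ≤ energy κ τ ν := by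
  rw [energy_comm hker hτ.1 hμ.1, energy_comm hker hτ.1 hν.1]
  exact (ENNReal.toReal_le_toReal (energy_ne_top hE hμ hτ) (energy_ne_top hE hν hτ)).1 h

end Concentration

section Projection

variable {κ : X → X → ℝ≥0∞} {A : Set X} {μ ν τ b : Measure X}

theorem nonneg_of_forall_quadratic {x y : ℝ}
    (h : ∀ t : ℝ, 0 ≤ t → t ≤ 1 → 0 ≤ 2 * t * x + t ^ 2 * y) : 0 ≤ x := by
  by_contra! hx
  have hpos : 0 < -x + |y| + 1 := by linarith [abs_nonneg y]
  have ht : 0 < -x / (-x + |y| + 1) := div_pos (by linarith) hpos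
  have h1 := h _ ht.le ((div_le_one hpos).2 (by linarith [abs_nonneg y]))
  have h2 : -x / (-x + |y| + 1) * (-x + |y| + 1) = -x := div_mul_cancel₀ _ hpos.ne'
  set t := -x / (-x + |y| + 1)
  have h3 : t * y ≤ t * |y| := mul_le_mul_of_nonneg_left (le_abs_self y) ht.le
  have h4 : 0 < t * -x := mul_pos ht (by linarith)
  nlinarith

/-- Orthogonal projection onto the strong closure of a convex cone. -/
theorem exists_projection (hker : IsKernel κ) (hE : EnergyPrinciple κ) (hC : Consistent κ)
    {C : Set (Measure X)} (hCE : C ⊆ Eplus κ) (h0 : 0 ∈ C)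
    (hadd : ∀ μ ∈ C, ∀ ν ∈ C, μ + ν ∈ C) (hsmul : ∀ (c : ℝ≥0), ∀ μ ∈ C, c • μ ∈ C)
    (hμ : μ ∈ Eplus κ) :
    ∃ b ∈ Eplus κ, ∃ c : ℕ → Measure X, (∀ n, c n ∈ C) ∧
      Tendsto (fun n => sqDist κ (c n) b) atTop (𝓝 0) ∧
      (∃ G : Ultrafilter ℕ, VagueConv (G : Filter ℕ) c b) ∧
      (∀ τ ∈ C, realEnergy κ μ τ ≤ realEnergy κ b τ) ∧
      realEnergy κ μ b = realEnergy κ b b := by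
  set d := sInf (sqDist κ μ '' C)
  have hd : ∀ c ∈ C, d ≤ sqDist κ μ c := fun c hc => csInf_le
    ⟨0, by rintro _ ⟨c, hc, rfl⟩; exact sqDist_nonneg hE hμ (hCE hc)⟩ (mem_image_of_mem _ hc)
  have hex (n : ℕ) : ∃ c ∈ C, sqDist κ μ c < d + 1 / ((n : ℝ) + 1) := by
    obtain ⟨_, ⟨c, hc, rfl⟩, h⟩ := exists_lt_of_csInf_lt (s := sqDist κ μ '' C)
      ⟨_, mem_image_of_mem _ h0⟩ (lt_add_of_pos_right d (Nat.one_div_pos_of_nat (n := n)))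
    exact ⟨c, hc, h⟩
  choose c hcC hc using hex
  have hcE (n : ℕ) := hCE (hcC n)
  obtain ⟨b, hb, hlim, hG⟩ := exists_strong_limit hker hE hC hcE
    (M := 2 * (d + 1) + 2 * realEnergy κ μ μ) (fun n => by
      have h1 := sqDist_smul_right hker 2 (hcE n) hμ
      have h2 := sqDist_nonneg hE (hcE n) (smul_mem_Eplus hker 2 hμ)
      have h3 := hc n
      have h4 : 1 / ((n : ℝ) + 1) ≤ 1 := by
        rw [div_le_one (by positivity)]
        linarith [n.cast_nonneg (α := ℝ)]
      rw [sqDist, realEnergy_comm hker hμ (hcE n)] at h3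
      push_cast at h1
      linarith) (fun ε hε => by
      obtain ⟨N, hN⟩ := exists_nat_one_div_lt (show 0 < ε / 4 by positivity)
      refine ⟨N, fun i hi j hj => ?_⟩
      have h1 := sqDist_eq_parallelogram hker hE hμ (hcE i) (hcE j)
      have h2 := hd _ (hsmul (1 / 2) _ (hadd _ (hcC i) _ (hsmul 1 _ (hcC j))))
      have h3 (i : ℕ) (hi : i ≥ N) : sqDist κ μ (c i) < d + ε / 4 :=
        (hc i).trans_le (by linarith [Nat.one_div_le_one_div (α := ℝ) hi])
      linarith [h3 i hi, h3 j hj])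
  have hlimμ := tendsto_sqDist hker hE hcE hb hlim hμ
  have hbd : sqDist κ μ b ≤ d := by
    refine le_of_tendsto_of_tendsto' hlimμ ?_ fun n => (hc n).le
    simpa using tendsto_one_div_add_atTop_nhds_zero_nat.const_add d
  have hvar : ∀ τ ∈ C, realEnergy κ μ τ ≤ realEnergy κ b τ := by
    intro τ hτ
    rw [← sub_nonneg]
    refine nonneg_of_forall_quadratic (y := realEnergy κ τ τ) fun t ht _ => ?_
    lift t to ℝ≥0 using ht
    have h1 := ((hlimμ.add (((tendsto_realEnergy hker hE hcE hb hlim (hCE hτ)).sub_const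
      (realEnergy κ μ τ)).const_mul (2 * (t : ℝ)))).add_const ((t : ℝ) ^ 2 * realEnergy κ τ τ))
    have h2 := ge_of_tendsto' (b := d) h1 fun n => by
      rw [← sqDist_add_smul_right hker hE t hμ (hcE n) (hCE hτ)]
      exact hd _ (hadd _ (hcC n) _ (hsmul t _ hτ))
    linarith
  refine ⟨b, hb, c, hcC, hlim, hG, hvar, le_antisymm ?_ ?_⟩
  · rw [realEnergy_comm hker hμ hb]
    refine le_of_tendsto_of_tendsto' (tendsto_realEnergy hker hE hcE hb hlim hμ)
      (tendsto_realEnergy hker hE hcE hb hlim hb) fun n => ?_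
    rw [realEnergy_comm hker (hcE n) hμ, realEnergy_comm hker (hcE n) hb]
    exact hvar _ (hcC n)
  · rw [← sub_nonneg]
    refine nonneg_of_forall_quadratic (y := realEnergy κ b b) fun t ht ht1 => ?_
    obtain ⟨s, rfl⟩ : ∃ s : ℝ≥0, t = 1 - s :=
      ⟨Real.toNNReal (1 - t), by rw [Real.coe_toNNReal _ (by linarith)]; ring⟩
    have h1 := ((((tendsto_realEnergy hker hE hcE hb hlim hμ).const_mul
      (2 * (s : ℝ))).const_sub (realEnergy κ μ μ))).add
      ((tendsto_realEnergy_self hker hE hcE hb hlim).const_mul ((s : ℝ) ^ 2))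
    have h2 := ge_of_tendsto' (b := d) h1 fun n => by
      rw [realEnergy_comm hker (hcE n) hμ, ← sqDist_smul_right hker s hμ (hcE n)]
      exact hd _ (hsmul s _ (hcC n))
    rw [realEnergy_comm hker hb hμ] at h2
    rw [sqDist] at hbd
    linarith

theorem sqDist_add_sqDist_le (h : realEnergy κ μ τ ≤ realEnergy κ b τ)
    (hb : realEnergy κ μ b = realEnergy κ b b) :
    sqDist κ μ b + sqDist κ b τ ≤ sqDist κ μ τ := by
  simp only [sqDist]
  linarith

theorem VagueConv.measure_eq_zero {ι : Type*} {G : Filter ι} [G.NeBot] {m : ι → Measure X}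
    (hm : ∀ i, IsRadon (m i)) (hν : IsRadon ν) (h : VagueConv G m ν) {U : Set X}
    (hU : IsOpen U) (h0 : ∀ i, m i U = 0) : ν U = 0 := by
  have := hν.1
  have := hν.2
  have hfin (i : ι) : IsFiniteMeasureOnCompacts (m i) := by
    have := (hm i).2
    infer_instance
  have hlsc : LowerSemicontinuous (U.indicator fun _ => (1 : ℝ≥0∞)) :=
    hU.lowerSemicontinuous_indicator (by simp)
  by_contra hpos
  have hlt : 0 < ∫⁻ x, U.indicator (fun _ => (1 : ℝ≥0∞)) x ∂ν := by
    rw [lintegral_indicator_const hU.measurableSet, one_mul]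
    exact pos_iff_ne_zero.2 hpos
  obtain ⟨i, hi⟩ := (Balayage.eventually_lt_lintegral hlsc (l := G)
    (F := fun _ => U.indicator fun _ => (1 : ℝ≥0∞)) (h.eventually_lt_lintegral hfin)
    (fun c x hcx => ⟨_, hlsc x c hcx, Eventually.of_forall fun _ _ hy => hy⟩) hlt).exists
  simp [lintegral_indicator_const hU.measurableSet, h0 i] at hi

/-- Balayage onto a compact set. -/
theorem exists_projection_of_isCompact (hker : IsKernel κ) (hE : EnergyPrinciple κ)
    (hC : Consistent κ) (hμ : μ ∈ Eplus κ) {K : Set X} (hK : IsCompact K) :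
    ∃ b ∈ compactCone κ K, (∀ᵐ x ∂b, pot κ b x ≤ pot κ μ x) ∧
      ∀ τ ∈ compactCone κ K, sqDist κ μ b ≤ sqDist κ μ τ := by
  obtain ⟨b, hb, c, hc, -, ⟨G, hG⟩, hvar, heq⟩ := exists_projection hker hE hC
    (C := compactCone κ K) (fun τ hτ => hτ.1) zero_mem_compactCone
    (fun μ hμ ν hν => add_mem_compactCone hker hE hμ hν)
    (fun t μ hμ => smul_mem_compactCone hker t hμ) hμ
  have hbK : b Kᶜ = 0 := hG.measure_eq_zero (fun n => (hc n).1.1) hb.1 hK.isClosed.isOpen_compl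
    fun n => measure_compl_of_mem_compactCone (hc n)
  refine ⟨b, ⟨hb, K, Subset.rfl, hK, hbK⟩, ?_, fun τ hτ => ?_⟩
  · have h1 : ∀ᵐ x ∂b, pot κ μ x ≤ pot κ b x := ae_pot_le hker hE hb hμ hb hbK fun L hL hLc => by
      have hLK := restrict_mem_compactCone hb hLc hL
      exact energy_le_of_realEnergy_le hker hE hμ hb hLK.1 (hvar _ hLK)
    have := hb.1.1
    have h2 := ae_eq_of_ae_le_of_lintegral_le h1 (energy_ne_top hE hb hμ)
      (measurable_pot hker b).aemeasurable
      (energy_le_of_realEnergy_le hker hE hb hμ hb heq.ge)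
    exact h2.symm.le
  · linarith [sqDist_add_sqDist_le (hvar τ hτ) heq, sqDist_nonneg hE hb hτ.1]

theorem exists_seq_of_mem_EclosOn (hE : EnergyPrinciple κ) (hker : IsKernel κ)
    (hν : ν ∈ EclosOn κ A) :
    ∃ m : ℕ → Measure X, (∀ n, m n ∈ EplusOn κ A) ∧
      Tendsto (fun n => sqDist κ (m n) ν) atTop (𝓝 0) := by
  choose m hm hlt using fun n : ℕ => hν.2 _ (Nat.one_div_pos_of_nat (n := n))
  refine ⟨m, hm, ?_⟩
  have h1 := (squeeze_zero (f := fun n => strDist κ ν (m n)) (fun n => Real.sqrt_nonneg _)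
    (fun n => (hlt n).le) tendsto_one_div_add_atTop_nhds_zero_nat).pow 2
  simp_rw [strDist_eq_sqrt, Real.sq_sqrt (sqDist_nonneg hE hν.1 (hm _).1),
    sqDist_comm hker hν.1 (hm _).1] at h1
  simpa using h1

theorem mem_EclosOn_of_tendsto (hker : IsKernel κ) (hν : ν ∈ Eplus κ)
    {m : ℕ → Measure X} (hm : ∀ n, m n ∈ EplusOn κ A)
    (h : Tendsto (fun n => sqDist κ (m n) ν) atTop (𝓝 0)) : ν ∈ EclosOn κ A := by
  refine ⟨hν, fun ε hε => ?_⟩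
  obtain ⟨n, hn⟩ := (h.eventually_lt_const (show 0 < ε ^ 2 by positivity)).exists
  refine ⟨m n, hm n, ?_⟩
  rwa [strDist_eq_sqrt, Real.sqrt_lt' hε, sqDist_comm hker hν (hm n).1]

/-- A measure in `E'_A` is determined by the values of its potential nearly everywhere on `A`. -/
theorem eq_of_mem_EclosOn (hker : IsKernel κ) (hE : EnergyPrinciple κ) (hμ : μ ∈ Eplus κ)
    (hν : ν ∈ EclosOn κ A) (hb : b ∈ EclosOn κ A)
    (hνμ : NEOn κ A fun x => pot κ ν x = pot κ μ x)
    (hbμ : NEOn κ A fun x => pot κ b x = pot κ μ x) : ν = b := by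
  have := hμ.1.1
  have := hν.1.1.1
  have := hb.1.1.1
  have key : ∀ τ ∈ EplusOn κ A, realEnergy κ τ ν = realEnergy κ τ b := fun τ hτ => by
    have hτA := hτ.2.measure_compl hτ.1.1.1
    have h1 := hνμ.ae hker (measurableSet_eq_fun (measurable_pot hker ν) (measurable_pot hker μ))
      hτ.1 hτA
    have h2 := hbμ.ae hker (measurableSet_eq_fun (measurable_pot hker b) (measurable_pot hker μ))
      hτ.1 hτA
    rw [realEnergy, realEnergy, energy, energy, lintegral_congr_ae]
    filter_upwards [h1, h2] with x h1 h2 using h1.trans h2.symm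
  have hlim : ∀ ρ ∈ EclosOn κ A, realEnergy κ ρ ν = realEnergy κ ρ b := fun ρ hρ => by
    obtain ⟨m, hm, hlim⟩ := exists_seq_of_mem_EclosOn hE hker hρ
    refine tendsto_nhds_unique (tendsto_realEnergy hker hE (fun n => (hm n).1) hρ.1 hlim hν.1) ?_
    simp_rw [key _ (hm _)]
    exact tendsto_realEnergy hker hE (fun n => (hm n).1) hρ.1 hlim hb.1
  refine eq_of_sqDist_eq_zero hE hν.1 hb.1 ?_
  rw [sqDist]
  linarith [hlim ν hν, hlim b hb, realEnergy_comm hker hν.1 hb.1]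

end Projection

theorem exists_isInnerBal {κ : X → X → ℝ≥0∞} (hker : IsKernel κ) (hE : EnergyPrinciple κ)
    (hC : Consistent κ) (hD : Domination κ) {μ : Measure X} (hμ : μ ∈ Eplus κ) (A : Set X) :
    ∃ b, IsInnerBal κ A μ b ∧ b ∈ EclosOn κ A := by
  obtain ⟨b, hb, c, hc, hlim, -, hvar, heq⟩ := exists_projection hker hE hC
    (C := compactCone κ A) (fun τ hτ => hτ.1) zero_mem_compactCone
    (fun μ hμ ν hν => add_mem_compactCone hker hE hμ hν)
    (fun t μ hμ => smul_mem_compactCone hker t hμ) hμ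
  have hbal (n : ℕ) : ∃ a ∈ compactCone κ A, (∀ᵐ x ∂a, pot κ a x ≤ pot κ μ x) ∧
      sqDist κ μ a ≤ sqDist κ μ (c n) := by
    obtain ⟨K, hKA, hK, h0⟩ := (hc n).2
    obtain ⟨a, ha, hle, hmin⟩ := exists_projection_of_isCompact hker hE hC hμ hK
    exact ⟨a, ⟨ha.1, K, hKA, hK, measure_compl_of_mem_compactCone ha⟩, hle,
      hmin _ ⟨(hc n).1, K, Subset.rfl, hK, h0⟩⟩
  choose a ha hle hmin using hbal
  have hlima : Tendsto (fun n => sqDist κ (a n) b) atTop (𝓝 0) := by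
    have h1 := (tendsto_sqDist hker hE (fun n => (hc n).1) hb hlim hμ).sub_const (sqDist κ μ b)
    rw [sub_self] at h1
    refine squeeze_zero (fun n => sqDist_nonneg hE (ha n).1 hb) (fun n => ?_) h1
    rw [sqDist_comm hker (ha n).1 hb]
    linarith [hmin n, sqDist_add_sqDist_le (hvar _ (ha n)) heq]
  have hminimal : ∀ ν ∈ InnerLam κ A μ, ∀ x, pot κ b x ≤ pot κ ν x := by
    intro ν hν
    have := hμ.1.1
    have := hν.1.1.1
    have h1 (n : ℕ) : ∀ x, pot κ (a n) x ≤ pot κ ν x := by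
      refine hD _ (ha n).1 _ hν.1 ?_
      filter_upwards [hle n, hν.2.ae hker (measurableSet_le (measurable_pot hker μ)
        (measurable_pot hker ν)) (ha n).1 (measure_compl_of_mem_compactCone (ha n))]
        with x h1 h2 using h1.trans h2
    have h2 : ∀ τ ∈ Eplus κ, realEnergy κ b τ ≤ realEnergy κ ν τ := fun τ hτ => by
      refine le_of_tendsto' (tendsto_realEnergy hker hE (fun n => (ha n).1) hb hlima hτ)
        fun n => ?_
      rw [realEnergy_comm hker (ha n).1 hτ, realEnergy_comm hker hν.1 hτ]
      exact ENNReal.toReal_mono (energy_ne_top hE hτ hν.1) (lintegral_mono (h1 n))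
    refine hD b hb ν hν.1 (ae_pot_le hker hE hb hb hν.1 (A := univ) (by simp) fun L _ hL => ?_)
    have hbL := restrict_mem_Eplus hb hL
    exact energy_le_of_realEnergy_le hker hE hb hν.1 hbL (h2 _ hbL)
  refine ⟨b, ⟨⟨hb, neOn_of_forall_ae fun τ hτ h0 => ?_⟩, hminimal⟩,
    mem_EclosOn_of_tendsto hker hb (fun n => compactCone_subset_EplusOn (hc n)) hlim⟩
  refine ae_pot_le hker hE hτ hμ hb h0 fun L hL hLc => ?_
  have hLA := restrict_mem_compactCone hτ hLc (hL.trans fun x hx => hx.1 : L ⊆ A)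
  exact energy_le_of_realEnergy_le hker hE hμ hb hLA.1 (hvar _ hLA)

/-- The inner balayage belongs to `E'_A` and is the unique measure there whose
potential equals `κμ` nearly everywhere on `A`. -/
theorem statement1 (κ : X → X → ℝ≥0∞) (hker : IsKernel κ)
    (hE : EnergyPrinciple κ) (hC : Consistent κ) (hD : Domination κ) :
    ∀ μ ∈ Eplus κ, ∀ A : Set X,
      ∃ b : Measure X, IsInnerBal κ A μ b ∧ b ∈ EclosOn κ A ∧
        NEOn κ A (fun x => pot κ b x = pot κ μ x) ∧
        (∀ ν ∈ EclosOn κ A, NEOn κ A (fun x => pot κ ν x = pot κ μ x) → ν = b) := by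
  intro μ hμ A
  obtain ⟨b, hbal, hb⟩ := exists_isInnerBal hker hE hC hD hμ A
  have h0 (P : X → Prop) (hP : ∀ x, P x) : NEOn κ A P :=
    neOn_of_forall_ae fun τ _ _ => Eventually.of_forall hP
  have hle := hbal.2 μ ⟨hμ, h0 _ fun x => le_rfl⟩
  have hbμ : NEOn κ A fun x => pot κ b x = pot κ μ x := by
    have h1 := hbal.1.2
    simp only [NEOn] at h1 ⊢
    simpa only [le_antisymm_iff, hle, true_and] using h1
  exact ⟨b, hbal, hb, hbμ, fun ν hν h => eq_of_mem_EclosOn hker hE hμ hν hb h hbμ⟩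

end Balayage
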